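/- arXiv:1707.03315 — 5 statements merged into one kernel-verified Lean document; each statement's English description precedes it below -/
import Mathlib

section
/- Let 0 < b¹₁ < b¹₂ < b²₂ and K₁, κ₁, α > 0. Let v : (0, ∞) → ℝ be continuous, differentiable on (0, b²₂), and satisfy: v(x) = v(b¹₂) − K₁ − (κ₁/α)(b¹₂ − x) for all x ∈ (0, b¹₁]; v'(x) ≥ κ₁/α for all x ∈ (b¹₁, b¹₂]; v'(x) < κ₁/α for all x ∈ (b¹₂, b²₂); and v(x) = v(b²₂) for all x ≥ b²₂. Then for every x ∈ (0, b¹₂], sup_{ξ ≥ 0} { v(x + αξ) − K₁ − κ₁ξ } = v(b¹₂) − K₁ − (κ₁/α)(b¹₂ − x), and the supremum is attained at ξ = (b¹₂ − x)/α; and for every x > b¹₂, sup_{ξ ≥ 0} { v(x + αξ) − K₁ − κ₁ξ } = v(x) − K₁, attained at ξ = 0. -/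
open Set

/-- Formula (3.20): computation of the firm's intervention operator
`M₁v(x) = sup_{ξ ≥ 0} { v(x + αξ) − K₁ − κ₁ξ }` for the candidate equilibrium value,
under the derivative conditions (3.12) and (3.13) of the Verification Theorem. -/
theorem firm_intervention_operator
    (b11 b12 b22 K1 κ1 α : ℝ)
    (hb11 : 0 < b11) (hb1 : b11 < b12) (hb2 : b12 < b22)
    (hK1 : 0 < K1) (hκ1 : 0 < κ1) (hα : 0 < α)
    (v : ℝ → ℝ)
    (hcont : ContinuousOn v (Ioi 0))
    (hdiff : ∀ x ∈ Ioo 0 b22, DifferentiableAt ℝ v x)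
    (hlow : ∀ x ∈ Ioc 0 b11, v x = v b12 - K1 - (κ1 / α) * (b12 - x))
    (hmid : ∀ x ∈ Ioc b11 b12, κ1 / α ≤ deriv v x)
    (hup : ∀ x ∈ Ioo b12 b22, deriv v x < κ1 / α)
    (hconst : ∀ x, b22 ≤ x → v x = v b22) :
    (∀ x ∈ Ioc 0 b12,
      IsGreatest ((fun ξ => v (x + α * ξ) - K1 - κ1 * ξ) '' Ici 0)
        (v b12 - K1 - (κ1 / α) * (b12 - x)) ∧
      v (x + α * ((b12 - x) / α)) - K1 - κ1 * ((b12 - x) / α)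
        = v b12 - K1 - (κ1 / α) * (b12 - x)) ∧
    (∀ x, b12 < x →
      IsGreatest ((fun ξ => v (x + α * ξ) - K1 - κ1 * ξ) '' Ici 0) (v x - K1) ∧
      v (x + α * 0) - K1 - κ1 * 0 = v x - K1) := by
  obtain ⟨c, hc⟩ : ∃ c, c = κ1 / α := ⟨_, rfl⟩
  have hκ : κ1 = c * α := by rw [hc]; field_simp
  have hc0 : 0 < c := by rw [hc]; positivity
  simp only [← hc] at hlow hmid hup ⊢
  have hA : ∀ x ∈ Icc b12 b22, ∀ y ∈ Icc b12 b22, x ≤ y → v y - v x ≤ c * (y - x) := by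
    apply (convex_Icc b12 b22).image_sub_le_mul_sub_of_deriv_le
    · exact hcont.mono fun z hz => by
        have := hz.1
        simp only [mem_Ioi]; linarith
    · rw [interior_Icc]
      intro z hz
      exact (hdiff z ⟨by linarith [hz.1], hz.2⟩).differentiableWithinAt
    · rw [interior_Icc]
      intro z hz
      exact (hup z hz).le
  have hB : ∀ x ∈ Icc b11 b12, ∀ y ∈ Icc b11 b12, x ≤ y → c * (y - x) ≤ v y - v x := by
    apply (convex_Icc b11 b12).mul_sub_le_image_sub_of_le_deriv
    · exact hcont.mono fun z hz => by
        have := hz.1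
        simp only [mem_Ioi]; linarith
    · rw [interior_Icc]
      intro z hz
      exact (hdiff z ⟨by linarith [hz.1], by linarith [hz.2]⟩).differentiableWithinAt
    · rw [interior_Icc]
      intro z hz
      exact hmid z ⟨hz.1, hz.2.le⟩
  have hA' : ∀ x y, b12 ≤ x → x ≤ y → v y - v x ≤ c * (y - x) := by
    intro x y hx hxy
    rcases le_total y b22 with hy | hy
    · exact hA x ⟨hx, hxy.trans hy⟩ y ⟨hx.trans hxy, hy⟩ hxy
    · rcases le_total x b22 with hx2 | hx2
      · have h1 := hA x ⟨hx, hx2⟩ b22 ⟨hb2.le, le_rfl⟩ hx2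
        rw [hconst y hy]
        nlinarith
      · rw [hconst y hy, hconst x hx2]
        nlinarith
  have hM : ∀ y, 0 < y → v y ≤ v b12 - c * (b12 - y) := by
    intro y hy
    rcases le_total y b11 with h | h
    · rw [hlow y ⟨hy, h⟩]; linarith
    · rcases le_total y b12 with h2 | h2
      · linarith [hB y ⟨h, h2⟩ b12 ⟨hb1.le, le_rfl⟩ h2]
      · linarith [hA' b12 y le_rfl h2]
  have hE : ∀ x, v (x + α * ((b12 - x) / α)) - K1 - κ1 * ((b12 - x) / α)
        = v b12 - K1 - c * (b12 - x) := by
    intro x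
    have h1 : α * ((b12 - x) / α) = b12 - x := by field_simp
    rw [hκ, mul_assoc, h1]
    congr 3
    ring
  refine ⟨fun x hx => ⟨⟨⟨(b12 - x) / α, ?_, hE x⟩, ?_⟩, hE x⟩,
    fun x hx => ⟨⟨⟨0, le_refl (0:ℝ), by simp⟩, ?_⟩, by simp⟩⟩
  · exact div_nonneg (by linarith [hx.2]) hα.le
  · rintro _ ⟨ξ, hξ, rfl⟩
    have h0 : 0 ≤ α * ξ := mul_nonneg hα.le hξ
    have := hM (x + α * ξ) (by linarith [hx.1])
    simp only [hκ]
    linarith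
  · rintro _ ⟨ξ, hξ, rfl⟩
    have h0 : 0 ≤ α * ξ := mul_nonneg hα.le hξ
    have := hA' x (x + α * ξ) hx.le (by linarith)
    simp only [hκ]
    linarith
end

section
/- Let 0 < b¹₁ < b¹₂ < b²₂ and K₁, κ₁, α > 0. Let v : (0, ∞) → ℝ be continuous, differentiable on (0, b²₂), and satisfy: v(x) = v(b¹₂) − K₁ − (κ₁/α)(b¹₂ − x) for all x ∈ (0, b¹₁]; v'(x) ≥ κ₁/α for all x ∈ (b¹₁, b¹₂]; v'(x) < κ₁/α for all x ∈ (b¹₂, b²₂); and v(x) = v(b²₂) for all x ≥ b²₂. Then v(x) ≥ sup_{ξ ≥ 0} { v(x + αξ) − K₁ − κ₁ξ } for every x > 0, with equality for all x ∈ (0, b¹₁]. -/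
open Set

/-- Step 2 of the proof of the Verification Theorem:
`v₁(x) ≥ (M₁v₁)(x) = sup_{ξ ≥ 0}{ v₁(x + αξ) − K₁ − κ₁ξ }` for all `x > 0`,
with equality for `x ∈ (0, b¹₁]`. -/
theorem firm_value_dominates_intervention_operator
    (b11 b12 b22 K1 κ1 α : ℝ)
    (hb11 : 0 < b11) (hb1 : b11 < b12) (hb2 : b12 < b22)
    (hK1 : 0 < K1) (hκ1 : 0 < κ1) (hα : 0 < α)
    (v : ℝ → ℝ)
    (hcont : ContinuousOn v (Ioi 0))
    (hdiff : ∀ x ∈ Ioo 0 b22, DifferentiableAt ℝ v x)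
    (hlow : ∀ x ∈ Ioc 0 b11, v x = v b12 - K1 - (κ1 / α) * (b12 - x))
    (hmid : ∀ x ∈ Ioc b11 b12, κ1 / α ≤ deriv v x)
    (hup : ∀ x ∈ Ioo b12 b22, deriv v x < κ1 / α)
    (hconst : ∀ x, b22 ≤ x → v x = v b22) :
    (∀ x ∈ Ioi (0:ℝ), ∀ ξ ∈ Ici (0:ℝ), v (x + α * ξ) - K1 - κ1 * ξ ≤ v x) ∧
    (∀ x ∈ Ioc 0 b11,
      IsGreatest ((fun ξ => v (x + α * ξ) - K1 - κ1 * ξ) '' Ici 0) (v x)) := by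
  set c := κ1 / α with hc
  have hcpos : 0 < c := div_pos hκ1 hα
  have hcα : c * α = κ1 := by rw [hc]; field_simp
  have hd : ∀ x ∈ Ioo 0 b22, HasDerivAt (fun x => v x - c * x) (deriv v x - c) x := by
    intro x hx
    have h1 := (hdiff x hx).hasDerivAt
    have h2 := (hasDerivAt_id x).const_mul c
    have h3 := h1.sub h2
    rw [mul_one] at h3
    exact h3
  have hwc : ContinuousOn (fun x => v x - c * x) (Ioi 0) := by fun_prop
  have hmono : MonotoneOn (fun x => v x - c * x) (Icc b11 b12) := by
    apply monotoneOn_of_deriv_nonneg (convex_Icc _ _)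
    · exact hwc.mono (fun x hx => lt_of_lt_of_le hb11 hx.1)
    · intro x hx
      rw [interior_Icc] at hx
      exact (hd x ⟨hb11.trans hx.1, hx.2.trans hb2⟩).differentiableAt.differentiableWithinAt
    · intro x hx
      rw [interior_Icc] at hx
      rw [(hd x ⟨hb11.trans hx.1, hx.2.trans hb2⟩).deriv]
      linarith [hmid x ⟨hx.1, hx.2.le⟩]
  have h0 : 0 < b12 := hb11.trans hb1
  have hanti : AntitoneOn (fun x => v x - c * x) (Icc b12 b22) := by
    apply antitoneOn_of_deriv_nonpos (convex_Icc _ _)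
    · exact hwc.mono (fun x hx => lt_of_lt_of_le h0 hx.1)
    · intro x hx
      rw [interior_Icc] at hx
      exact (hd x ⟨h0.trans hx.1, hx.2⟩).differentiableAt.differentiableWithinAt
    · intro x hx
      rw [interior_Icc] at hx
      rw [(hd x ⟨h0.trans hx.1, hx.2⟩).deriv]
      linarith [hup x hx]
  have hanti2 : ∀ x y, b12 ≤ x → x ≤ y → v y - c * y ≤ v x - c * x := by
    intro x y hx hxy
    rcases le_total y b22 with hy | hy
    · exact hanti ⟨hx, hxy.trans hy⟩ ⟨hx.trans hxy, hy⟩ hxy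
    · rcases le_total x b22 with hx2 | hx2
      · have h1 : v b22 - c * b22 ≤ v x - c * x := hanti ⟨hx, hx2⟩ ⟨hb2.le, le_rfl⟩ hx2
        have h2 := hconst y hy
        nlinarith
      · rw [hconst y hy, hconst x hx2]
        nlinarith
  have hl11 := hlow b11 ⟨hb11, le_rfl⟩
  have hmax : ∀ y, 0 < y → v y - c * y ≤ v b12 - c * b12 := by
    intro y hy
    rcases le_total y b11 with h | h
    · linarith [hlow y ⟨hy, h⟩]
    · rcases le_total y b12 with h' | h'
      · exact hmono ⟨h, h'⟩ ⟨hb1.le, le_rfl⟩ h'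
      · exact hanti2 _ _ le_rfl h'
  have hmin : ∀ x, 0 < x → x ≤ b12 → v b12 - c * b12 - K1 ≤ v x - c * x := by
    intro x hx hx2
    rcases le_total x b11 with h | h
    · linarith [hlow x ⟨hx, h⟩]
    · have h1 : v b11 - c * b11 ≤ v x - c * x := hmono ⟨le_rfl, hb1.le⟩ ⟨h, hx2⟩ h
      linarith
  have hmain : ∀ x ∈ Ioi (0:ℝ), ∀ ξ ∈ Ici (0:ℝ), v (x + α * ξ) - K1 - κ1 * ξ ≤ v x := by
    intro x hx ξ hξ
    have hx' : 0 < x := hx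
    have hξ' : 0 ≤ ξ := hξ
    have hp : 0 ≤ α * ξ := mul_nonneg hα.le hξ'
    have e : c * (x + α * ξ) = c * x + κ1 * ξ := by rw [← hcα]; ring
    rcases le_total x b12 with h | h
    · have h1 := hmax (x + α * ξ) (by linarith)
      have h2 := hmin x hx' h
      linarith
    · have h1 := hanti2 x (x + α * ξ) h (by linarith)
      linarith
  refine ⟨hmain, fun x hx => ⟨⟨(b12 - x) / α, ?_, ?_⟩, ?_⟩⟩
  · exact div_nonneg (by linarith [hx.2]) hα.le
  · have e1 : x + α * ((b12 - x) / α) = b12 := by field_simp; ring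
    have e2 : κ1 * ((b12 - x) / α) = c * (b12 - x) := by rw [hc]; ring
    simp only [e1, e2]
    exact (hlow x hx).symm
  · rintro _ ⟨ξ, hξ, rfl⟩
    exact hmain x hx.1 ξ hξ
end

section
/- Let 0 < b¹₁ < b²₁ < b²₂ and K₂, κ₂ > 0. Let v : (0, ∞) → ℝ be continuous, differentiable on (b¹₁, ∞), and satisfy: v(x) = v(b¹₁) for all x ∈ (0, b¹₁]; v'(x) < κ₂ for all x ∈ (b¹₁, b²₁); v'(x) ≥ κ₂ for all x ∈ [b²₁, b²₂); and v(x) = v(b²₁) + K₂ + κ₂(x − b²₁) for all x ≥ b²₂. Then for every x ≥ b²₁, inf_{0 ≤ η < x} { v(x − η) + K₂ + κ₂η } = v(b²₁) + K₂ + κ₂(x − b²₁), and the infimum is attained at η = x − b²₁; and for every x ∈ (0, b²₁), inf_{0 ≤ η < x} { v(x − η) + K₂ + κ₂η } = v(x) + K₂, attained at η = 0. -/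
open Set

/-- Computation of the government's intervention operator
`M₂v(x) = inf_{0 ≤ η < x} { v(x − η) + K₂ + κ₂η }` for the candidate equilibrium
value, under the derivative conditions (3.14) and (3.15) of the Verification Theorem. -/
theorem government_intervention_operator
    (b11 b21 b22 K2 κ2 : ℝ)
    (hb11 : 0 < b11) (hb1 : b11 < b21) (hb2 : b21 < b22)
    (hK2 : 0 < K2) (hκ2 : 0 < κ2)
    (v : ℝ → ℝ)
    (hcont : ContinuousOn v (Ioi 0))
    (hdiff : ∀ x ∈ Ioi b11, DifferentiableAt ℝ v x)
    (hlow : ∀ x ∈ Ioc 0 b11, v x = v b11)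
    (hmid : ∀ x ∈ Ioo b11 b21, deriv v x < κ2)
    (hup : ∀ x ∈ Ico b21 b22, κ2 ≤ deriv v x)
    (hhigh : ∀ x, b22 ≤ x → v x = v b21 + K2 + κ2 * (x - b21)) :
    (∀ x, b21 ≤ x →
      IsLeast ((fun η => v (x - η) + K2 + κ2 * η) '' Ico 0 x)
        (v b21 + K2 + κ2 * (x - b21)) ∧
      v (x - (x - b21)) + K2 + κ2 * (x - b21) = v b21 + K2 + κ2 * (x - b21)) ∧
    (∀ x ∈ Ioo 0 b21,
      IsLeast ((fun η => v (x - η) + K2 + κ2 * η) '' Ico 0 x) (v x + K2) ∧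
      v (x - 0) + K2 + κ2 * 0 = v x + K2) := by
  have hder : ∀ x, b11 < x → HasDerivAt (fun y => v y - κ2 * y) (deriv v x - κ2) x := by
    intro x hx
    have h1 := (hdiff x hx).hasDerivAt
    have h2 := (hasDerivAt_id x).const_mul κ2
    have h3 := h1.sub h2
    rw [mul_one] at h3
    exact h3
  have hc : ContinuousOn (fun y => v y - κ2 * y) (Ioi 0) :=
    hcont.sub (by fun_prop)
  have hanti : AntitoneOn (fun y => v y - κ2 * y) (Icc b11 b21) := by
    apply antitoneOn_of_deriv_nonpos (convex_Icc _ _)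
    · exact hc.mono fun y hy => lt_of_lt_of_le hb11 hy.1
    · intro y hy
      rw [interior_Icc] at hy
      exact (hder y hy.1).differentiableAt.differentiableWithinAt
    · intro y hy
      rw [interior_Icc] at hy
      rw [(hder y hy.1).deriv]
      linarith [hmid y hy]
  have hmono : MonotoneOn (fun y => v y - κ2 * y) (Icc b21 b22) := by
    apply monotoneOn_of_deriv_nonneg (convex_Icc _ _)
    · exact hc.mono fun y hy => lt_of_lt_of_le (hb11.trans hb1) hy.1
    · intro y hy
      rw [interior_Icc] at hy
      exact (hder y (hb1.trans hy.1)).differentiableAt.differentiableWithinAt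
    · intro y hy
      rw [interior_Icc] at hy
      rw [(hder y (hb1.trans hy.1)).deriv]
      linarith [hup y ⟨hy.1.le, hy.2⟩]
  have hA : ∀ y z, 0 < y → y ≤ z → z ≤ b21 → v z - κ2 * z ≤ v y - κ2 * y := by
    intro y z hy hyz hz
    rcases le_total b11 y with h | h
    · exact hanti ⟨h, hyz.trans hz⟩ ⟨h.trans hyz, hz⟩ hyz
    · have e1 := hlow y ⟨hy, h⟩
      rcases le_total b11 z with h' | h'
      · have e2 : v z - κ2 * z ≤ v b11 - κ2 * b11 :=
          hanti ⟨le_rfl, hb1.le⟩ ⟨h', hz⟩ h'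
        nlinarith
      · have e2 := hlow z ⟨hy.trans_le hyz, h'⟩
        nlinarith
  have hB : ∀ y, 0 < y → v b21 - κ2 * b21 ≤ v y - κ2 * y := by
    intro y hy
    rcases le_total y b21 with h | h
    · exact hA y b21 hy h le_rfl
    · rcases le_total y b22 with h' | h'
      · exact hmono ⟨le_rfl, hb2.le⟩ ⟨h, h'⟩ h
      · rw [hhigh y h']
        linarith
  refine ⟨fun x hx => ⟨⟨⟨x - b21, ⟨by linarith, by linarith⟩, by simp⟩, ?_⟩, by simp⟩,
    fun x hx => ⟨⟨⟨0, ⟨le_rfl, hx.1⟩, by simp⟩, ?_⟩, by simp⟩⟩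
  · rintro _ ⟨η, hη, rfl⟩
    have := hB (x - η) (by linarith [hη.2])
    show _ ≤ v (x - η) + K2 + κ2 * η
    linarith
  · rintro _ ⟨η, hη, rfl⟩
    have := hA (x - η) x (by linarith [hη.2]) (by linarith [hη.1]) hx.2.le
    show _ ≤ v (x - η) + K2 + κ2 * η
    linarith
end

section
/- Let 0 < b¹₁ < b²₁ < b²₂ and K₂, κ₂ > 0. Let v : (0, ∞) → ℝ be continuous, differentiable on (b¹₁, ∞), and satisfy: v(x) = v(b¹₁) for all x ∈ (0, b¹₁]; v'(x) < κ₂ for all x ∈ (b¹₁, b²₁); v'(x) ≥ κ₂ for all x ∈ [b²₁, b²₂); and v(x) = v(b²₁) + K₂ + κ₂(x − b²₁) for all x ≥ b²₂. Then v(x) ≤ inf_{0 ≤ η < x} { v(x − η) + K₂ + κ₂η } for every x > 0, with equality for all x ≥ b²₂. -/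
open Set

/-- Step 2 of the proof of the Verification Theorem (government's side):
`v₂(x) ≤ (M₂v₂)(x) = inf_{0 ≤ η < x}{ v₂(x − η) + K₂ + κ₂η }` for all `x > 0`,
with equality for `x ≥ b²₂`. -/
theorem government_value_dominated_by_intervention_operator
    (b11 b21 b22 K2 κ2 : ℝ)
    (hb11 : 0 < b11) (hb1 : b11 < b21) (hb2 : b21 < b22)
    (hK2 : 0 < K2) (hκ2 : 0 < κ2)
    (v : ℝ → ℝ)
    (hcont : ContinuousOn v (Ioi 0))
    (hdiff : ∀ x ∈ Ioi b11, DifferentiableAt ℝ v x)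
    (hlow : ∀ x ∈ Ioc 0 b11, v x = v b11)
    (hmid : ∀ x ∈ Ioo b11 b21, deriv v x < κ2)
    (hup : ∀ x ∈ Ico b21 b22, κ2 ≤ deriv v x)
    (hhigh : ∀ x, b22 ≤ x → v x = v b21 + K2 + κ2 * (x - b21)) :
    (∀ x ∈ Ioi (0:ℝ), ∀ η ∈ Ico (0:ℝ) x, v x ≤ v (x - η) + K2 + κ2 * η) ∧
    (∀ x, b22 ≤ x →
      IsLeast ((fun η => v (x - η) + K2 + κ2 * η) '' Ico 0 x) (v x)) := by
  have hb21 : 0 < b21 := hb11.trans hb1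
  have hwc : ContinuousOn (fun x => v x - κ2 * x) (Ioi 0) := by fun_prop
  have hwd : ∀ x ∈ Ioi b11, HasDerivAt (fun x => v x - κ2 * x) (deriv v x - κ2) x := by
    intro x hx
    have h1 := (hdiff x hx).hasDerivAt
    have h2 := (hasDerivAt_id x).const_mul κ2
    have h3 := h1.sub h2
    rw [mul_one] at h3
    exact h3
  have hA : AntitoneOn (fun x => v x - κ2 * x) (Icc b11 b21) := by
    apply antitoneOn_of_deriv_nonpos (convex_Icc _ _)
    · exact hwc.mono fun x hx => lt_of_lt_of_le hb11 hx.1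
    · intro x hx
      rw [interior_Icc] at hx
      exact (hwd x hx.1).differentiableAt.differentiableWithinAt
    · intro x hx
      rw [interior_Icc] at hx
      rw [(hwd x hx.1).deriv]
      linarith [hmid x hx]
  have hM : MonotoneOn (fun x => v x - κ2 * x) (Icc b21 b22) := by
    apply monotoneOn_of_deriv_nonneg (convex_Icc _ _)
    · exact hwc.mono fun x hx => lt_of_lt_of_le hb21 hx.1
    · intro x hx
      rw [interior_Icc] at hx
      exact (hwd x (hb1.trans hx.1)).differentiableAt.differentiableWithinAt
    · intro x hx
      rw [interior_Icc] at hx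
      rw [(hwd x (hb1.trans hx.1)).deriv]
      linarith [hup x ⟨hx.1.le, hx.2⟩]
  have hanti : ∀ y x, 0 < y → y ≤ x → x ≤ b21 → v x - κ2 * x ≤ v y - κ2 * y := by
    intro y x hy hyx hx
    have hmul : ∀ a b : ℝ, a ≤ b → κ2 * a ≤ κ2 * b :=
      fun a b h => mul_le_mul_of_nonneg_left h hκ2.le
    rcases le_total y b11 with h1 | h1
    · rcases le_total x b11 with h2 | h2
      · rw [hlow y ⟨hy, h1⟩, hlow x ⟨hy.trans_le hyx, h2⟩]
        linarith [hmul _ _ hyx]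
      · have := hA ⟨le_rfl, hb1.le⟩ ⟨h2, hx⟩ h2
        simp only at this
        rw [hlow y ⟨hy, h1⟩]
        linarith [hmul _ _ h1]
    · exact hA ⟨h1, hyx.trans hx⟩ ⟨h1.trans hyx, hx⟩ hyx
  have hmin : ∀ y, 0 < y → v b21 - κ2 * b21 ≤ v y - κ2 * y := by
    intro y hy
    rcases le_total y b21 with h | h
    · exact hanti y b21 hy h le_rfl
    · rcases le_total y b22 with h2 | h2
      · exact hM ⟨le_rfl, hb2.le⟩ ⟨h, h2⟩ h
      · rw [hhigh y h2]; linarith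
  have hmax : ∀ x, b21 ≤ x → v x - κ2 * x ≤ v b21 - κ2 * b21 + K2 := by
    intro x hx
    rcases le_total x b22 with h2 | h2
    · have := hM ⟨hx, h2⟩ ⟨hb2.le, le_rfl⟩ h2
      simp only at this
      rw [hhigh b22 le_rfl] at this
      linarith
    · rw [hhigh x h2]; linarith
  have main : ∀ x ∈ Ioi (0:ℝ), ∀ η ∈ Ico (0:ℝ) x, v x ≤ v (x - η) + K2 + κ2 * η := by
    intro x hx η hη
    have hpos : 0 < x - η := by linarith [hη.2]
    rcases le_total x b21 with h | h
    · have := hanti (x - η) x hpos (by linarith [hη.1]) h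
      linarith
    · have h1 := hmin (x - η) hpos
      have h2 := hmax x h
      linarith
  refine ⟨main, fun x hx => ⟨⟨x - b21, ⟨by linarith, by linarith⟩, ?_⟩, ?_⟩⟩
  · simp only [sub_sub_cancel]
    rw [hhigh x hx]
  · rintro _ ⟨η, hη, rfl⟩
    exact main x (by simp only [mem_Ioi]; linarith) η hη
end

section
/- Let π, μ : (0, ∞) → ℝ, r₁ > 0, κ₁, α, K₁ > 0, and 0 < b¹₁ < b¹₂. Define θ₁(x) := π(x) + (κ₁/α)(μ(x) − r₁x) and suppose θ₁ is nondecreasing on (0, x̂₁] for some x̂₁ ≥ b¹₁. Let v₁(b¹₁), v₁(b¹₂) be real numbers with v₁(b¹₂) = v₁(b¹₁) + K₁ + (κ₁/α)(b¹₂ − b¹₁), and suppose π(b¹₁) + (κ₁/α)μ(b¹₁) − r₁·v₁(b¹₁) ≤ 0. Define v₁(x) := v₁(b¹₂) − K₁ − (κ₁/α)(b¹₂ − x) for x ∈ (0, b¹₁). Then π(x) + (κ₁/α)μ(x) − r₁·v₁(x) ≤ 0 for all x ∈ (0, b¹₁). -/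
open Set

/-- The chain of inequalities (3.19) in Step 1 of the proof of the Verification
Theorem: below `b¹₁`, where the candidate value is affine with slope `κ₁/α`, one has
`π(x) + (κ₁/α)μ(x) − r₁v₁(x) ≤ 0`. -/
theorem firm_generator_inequality_below
    (r1 κ1 α K1 b11 b12 xhat1 : ℝ)
    (hr1 : 0 < r1) (hκ1 : 0 < κ1) (hα : 0 < α) (hK1 : 0 < K1)
    (hb11 : 0 < b11) (hb : b11 < b12)
    (π μ : ℝ → ℝ)
    (hxhat : b11 ≤ xhat1)
    (hθ1 : MonotoneOn (fun x => π x + (κ1 / α) * (μ x - r1 * x)) (Ioc 0 xhat1))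
    (v11 v12 : ℝ)
    (hval : v12 = v11 + K1 + (κ1 / α) * (b12 - b11))
    (hineq : π b11 + (κ1 / α) * μ b11 - r1 * v11 ≤ 0)
    (v1 : ℝ → ℝ)
    (hv1 : ∀ x ∈ Ioo 0 b11, v1 x = v12 - K1 - (κ1 / α) * (b12 - x)) :
    ∀ x ∈ Ioo 0 b11, π x + (κ1 / α) * μ x - r1 * v1 x ≤ 0 := by
  intro x hx
  have h := hθ1 (show x ∈ Ioc 0 xhat1 from ⟨hx.1, hx.2.le.trans hxhat⟩)
    (show b11 ∈ Ioc 0 xhat1 from ⟨hb11, hxhat⟩) hx.2.le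
  simp only at h
  rw [hv1 x hx, hval]
  generalize κ1 / α = c at *
  linarith
end
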